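/- arXiv:1709.07259 — 2 statements merged into one kernel-verified Lean document; each statement's English description precedes it below -/
import Mathlib

section
/- Let φ ∈ (0,1), let H ≥ 1 be an integer, and let N = (1/φ)^H. Let C_1, …, C_{H−1}, C_{≥H} be independent random variables, where for each h ∈ {1,…,H−1} the variable C_h is obtained by drawing G_h on ℕ with P[G_h = g] = (1−φ^h)^g·φ^h and then, conditionally on G_h = g, drawing C_h binomially with g trials and success probability φ^{h−1}(1−φ)/(1−φ^h); and C_{≥H} is binomially distributed with N trials and success probability φ^{H−1}. Then E[Σ_{h=1}^{H−1} C_h + C_{≥H}] ≤ ((1−φ)/φ)·log_{1/φ}(N) + 1. -/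
open MeasureTheory ProbabilityTheory
open scoped ENNReal

/-- The mean of a binomial distribution with `n` trials and success probability `p` is `n * p`. -/
theorem tsum_mul_ofReal_binomial (n : ℕ) {p : ℝ} (hp0 : 0 ≤ p) (hp1 : p ≤ 1) :
    ∑' c : ℕ, (c : ℝ≥0∞) * ENNReal.ofReal ((n.choose c : ℝ) * p ^ c * (1 - p) ^ (n - c)) =
      ENNReal.ofReal (n * p) := by
  have h1p : 0 ≤ 1 - p := sub_nonneg.2 hp1
  have hmean := congrArg (Polynomial.eval p) (bernsteinPolynomial.sum_smul ℝ n)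
  simp only [Polynomial.eval_finsetSum, bernsteinPolynomial, nsmul_eq_mul, Polynomial.eval_mul,
    Polynomial.eval_natCast, Polynomial.eval_pow, Polynomial.eval_sub, Polynomial.eval_one,
    Polynomial.eval_X] at hmean
  rw [tsum_eq_sum (s := Finset.range (n + 1)), ← hmean, ENNReal.ofReal_sum_of_nonneg]
  · refine Finset.sum_congr rfl fun c _ => ?_
    rw [ENNReal.ofReal_mul (Nat.cast_nonneg c), ENNReal.ofReal_natCast]
  · intro c _
    positivity
  · intro c hc
    rw [Nat.choose_eq_zero_of_lt (by rw [Finset.mem_range] at hc; lia)]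
    simp

theorem lintegral_natCast_eq_tsum {Ω : Type*} [MeasurableSpace Ω] (μ : Measure Ω) {X : Ω → ℕ}
    (hX : Measurable X) :
    ∫⁻ ω, (X ω : ℝ≥0∞) ∂μ = ∑' c : ℕ, (c : ℝ≥0∞) * μ {ω | X ω = c} := by
  rw [← lintegral_map (f := fun c : ℕ => (c : ℝ≥0∞)) (measurable_of_countable _) hX,
    lintegral_countable']
  refine tsum_congr fun c => ?_
  rw [Measure.map_apply hX (measurableSet_singleton c)]
  rfl

theorem ENNReal.ofReal_tsum_le {ι : Type*} {f : ι → ℝ} (hf : ∀ i, 0 ≤ f i) :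
    ENNReal.ofReal (∑' i, f i) ≤ ∑' i, ENNReal.ofReal (f i) := by
  by_cases hs : Summable f
  · exact (ENNReal.ofReal_tsum_of_nonneg hf hs).le
  · simp [tsum_eq_zero_of_not_summable hs]

/-- The mean of a binomial count whose number of trials is geometric with parameter `q` is at most
`(1 - q) / q * p`. -/
theorem tsum_mul_ofReal_geometric_binomial_le {q p : ℝ} (hq0 : 0 < q) (hq1 : q ≤ 1)
    (hp0 : 0 ≤ p) (hp1 : p ≤ 1) :
    ∑' c : ℕ, (c : ℝ≥0∞) * ENNReal.ofReal (∑' g : ℕ, ((1 - q) ^ g * q) *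
        ((g.choose c : ℝ) * p ^ c * (1 - p) ^ (g - c))) ≤
      ENNReal.ofReal ((1 - q) / q * p) := by
  have h1p : 0 ≤ 1 - p := sub_nonneg.2 hp1
  have h1q : 0 ≤ 1 - q := sub_nonneg.2 hq1
  have hgeom : HasSum (fun g : ℕ => ((1 - q) ^ g * q) * (g * p)) ((1 - q) / q * p) := by
    have hs := (hasSum_coe_mul_geometric_of_norm_lt_one (r := 1 - q)
      (by rw [Real.norm_of_nonneg h1q]; linarith)).mul_right (q * p)
    convert hs using 1
    · rfl
    · funext g
      ring
    · rw [sub_sub_cancel]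
      field_simp
  calc
    _ ≤ ∑' c : ℕ, ∑' g : ℕ, ENNReal.ofReal ((1 - q) ^ g * q) *
          ((c : ℝ≥0∞) * ENNReal.ofReal ((g.choose c : ℝ) * p ^ c * (1 - p) ^ (g - c))) := by
      refine ENNReal.tsum_le_tsum fun c => ?_
      refine (mul_le_mul_right (ENNReal.ofReal_tsum_le fun g => by positivity) _).trans_eq ?_
      rw [← ENNReal.tsum_mul_left]
      refine tsum_congr fun g => ?_
      rw [ENNReal.ofReal_mul (by positivity), mul_left_comm]
    _ = ∑' g : ℕ, ENNReal.ofReal (((1 - q) ^ g * q) * (g * p)) := by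
      rw [ENNReal.tsum_comm]
      refine tsum_congr fun g => ?_
      rw [ENNReal.tsum_mul_left, tsum_mul_ofReal_binomial g hp0 hp1,
        ← ENNReal.ofReal_mul (by positivity)]
    _ = ENNReal.ofReal ((1 - q) / q * p) := by
      rw [← ENNReal.ofReal_tsum_of_nonneg (fun g => by positivity) hgeom.summable, hgeom.tsum_eq]

/-- Let `φ ∈ (0,1)`, `H ≥ 1` an integer and `N = (1/φ)^H`. Let `C 1, …, C (H-1), C H`
be independent random variables, where for `h ∈ {1, …, H-1}` the variable `C h` is a
geocoin experiment: it is obtained by drawing `G_h` with `P[G_h = g] = (1-φ^h)^g * φ^h`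
and then, conditionally on `G_h = g`, drawing `C h` binomially with `g` trials and
success probability `φ^(h-1)(1-φ)/(1-φ^h)`; and `C H` (the tail count `C_{≥H}`) is
binomially distributed with `N` trials and success probability `φ^(H-1)`.  Then
`E[∑_{h=1}^{H-1} C h + C H] ≤ ((1-φ)/φ) * log_{1/φ}(N) + 1`. -/
theorem geocoin_experiment_total_expectation
    {Ω : Type*} [MeasurableSpace Ω] (μ : Measure Ω) [IsProbabilityMeasure μ]
    (φ : ℝ) (hφ : φ ∈ Set.Ioo (0 : ℝ) 1) (H : ℕ) (hH : 1 ≤ H)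
    (N : ℕ) (hN : (N : ℝ) = (1 / φ) ^ H)
    (C : ℕ → Ω → ℕ)
    (hmeas : ∀ h, Measurable (C h))
    (hindep : iIndepFun C μ)
    (hgeocoin : ∀ h ∈ Finset.Icc 1 (H - 1), ∀ c : ℕ,
      μ {ω | C h ω = c} = ENNReal.ofReal (∑' g : ℕ, ((1 - φ ^ h) ^ g * φ ^ h) *
        ((g.choose c : ℝ) * (φ ^ (h - 1) * (1 - φ) / (1 - φ ^ h)) ^ c *
          (1 - φ ^ (h - 1) * (1 - φ) / (1 - φ ^ h)) ^ (g - c))))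
    (htail : ∀ c : ℕ,
      μ {ω | C H ω = c} = ENNReal.ofReal
        ((N.choose c : ℝ) * (φ ^ (H - 1)) ^ c * (1 - φ ^ (H - 1)) ^ (N - c))) :
    (∫⁻ ω, ((∑ h ∈ Finset.Icc 1 (H - 1), (C h ω : ℝ≥0∞)) + (C H ω : ℝ≥0∞)) ∂μ)
      ≤ ENNReal.ofReal ((1 - φ) / φ * Real.logb (1 / φ) (N : ℝ) + 1) := by
  obtain ⟨h0, h1⟩ := hφ
  have hlog : Real.logb (1 / φ) (N : ℝ) = H := by
    rw [hN, Real.logb_pow, Real.logb_self_eq_one (one_lt_one_div h0 h1), mul_one]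
  have hlevel : ∀ h ∈ Finset.Icc 1 (H - 1),
      ∫⁻ ω, (C h ω : ℝ≥0∞) ∂μ ≤ ENNReal.ofReal ((1 - φ) / φ) := by
    intro h hh
    have hh1 : 1 ≤ h := (Finset.mem_Icc.1 hh).1
    have hpow : φ ^ h = φ ^ (h - 1) * φ := by rw [← pow_succ, Nat.sub_add_cancel hh1]
    have hlt : φ ^ h < 1 := pow_lt_one₀ h0.le h1 (by lia)
    have hpos : 0 < 1 - φ ^ h := sub_pos.2 hlt
    have hpred : φ ^ (h - 1) ≤ 1 := pow_le_one₀ h0.le h1.le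
    rw [lintegral_natCast_eq_tsum μ (hmeas h)]
    simp_rw [hgeocoin h hh]
    refine (tsum_mul_ofReal_geometric_binomial_le (pow_pos h0 h) hlt.le ?_ ?_).trans_eq ?_
    · exact div_nonneg (mul_nonneg (by positivity) (sub_nonneg.2 h1.le)) hpos.le
    · rw [div_le_one hpos]
      linarith
    · congr 1
      rw [div_mul_div_cancel₀' hpos.ne', hpow]
      field_simp
  have hlast : ∫⁻ ω, (C H ω : ℝ≥0∞) ∂μ = ENNReal.ofReal ((1 - φ) / φ + 1) := by
    rw [lintegral_natCast_eq_tsum μ (hmeas H)]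
    simp_rw [htail]
    rw [tsum_mul_ofReal_binomial N (by positivity) (pow_le_one₀ h0.le h1.le), hN]
    obtain ⟨K, rfl⟩ := Nat.exists_eq_add_of_le' hH
    congr 1
    rw [Nat.add_sub_cancel, one_div, inv_pow, pow_succ]
    field_simp
    ring
  have hcast : ∀ h, Measurable fun ω => (C h ω : ℝ≥0∞) := fun h =>
    (measurable_of_countable (fun c : ℕ => (c : ℝ≥0∞))).comp (hmeas h)
  have hr : 0 ≤ (1 - φ) / φ := div_nonneg (sub_nonneg.2 h1.le) h0.le
  rw [lintegral_add_right _ (hcast H), lintegral_finsetSum _ fun h _ => hcast h, hlast, hlog]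
  calc
    _ ≤ (∑ _h ∈ Finset.Icc 1 (H - 1), ENNReal.ofReal ((1 - φ) / φ)) +
          ENNReal.ofReal ((1 - φ) / φ + 1) := by
      gcongr with h hh
      exact hlevel h hh
    _ = ENNReal.ofReal ((1 - φ) / φ * H + 1) := by
      rw [← ENNReal.ofReal_sum_of_nonneg fun _ _ => hr,
        ← ENNReal.ofReal_add (Finset.sum_nonneg fun _ _ => hr) (by positivity),
        Finset.sum_const, Nat.card_Icc, Nat.add_sub_cancel, nsmul_eq_mul, Nat.cast_sub hH]
      congr 1
      push_cast
      ring
end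

section
/- Let φ ∈ (0,1), let n be such that L := log₂(n) > 1, let β ≥ 0 and 𝔠 > 0 be reals, let h₁ be a positive integer with φ^{h₁} = L^{−(β+𝔠)}, and let N be a positive integer with N ≥ L^{β+2𝔠}. Let h_1, …, h_N be independent geometric heights with parameter φ, where index i corresponds to the data item of rank i, and let J = {i : h_i > h₁}. Then P[∃ i ∈ J with i ≤ L^{β}] ≤ L^{−𝔠}, and P[J ∩ [1, L^{β+2𝔠}] = ∅] ≤ exp(−(1/2)·L^{𝔠}). In particular, with probability at least 1 − L^{−𝔠} − exp(−(1/2)·L^{𝔠}), the smallest index i with h_i > h₁ satisfies L^{β} < i ≤ L^{β+2𝔠}. -/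
open MeasureTheory ProbabilityTheory
open scoped ENNReal

/-- The upper tail of a geometric distribution. -/
lemma measure_lt_of_geometric {Ω : Type*} [MeasurableSpace Ω] {μ : Measure Ω}
    {φ : ℝ} (hφ : φ ∈ Set.Ioo (0 : ℝ) 1) {Y : Ω → ℕ} (hY : Measurable Y)
    (hdist : ∀ j : ℕ, 1 ≤ j → μ {ω | Y ω = j} = ENNReal.ofReal (φ ^ (j - 1) * (1 - φ)))
    (k : ℕ) : μ {ω | k < Y ω} = ENNReal.ofReal (φ ^ k) := by
  have hset : {ω | k < Y ω} = ⋃ m : ℕ, {ω | Y ω = k + 1 + m} := by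
    ext ω
    simp only [Set.mem_ofPred_eq, Set.mem_iUnion]
    exact ⟨fun h => ⟨Y ω - (k + 1), by omega⟩, fun ⟨m, hm⟩ => by omega⟩
  have hsum : HasSum (fun m : ℕ => φ ^ (k + m) * (1 - φ)) (φ ^ k) := by
    have h := ((hasSum_geometric_of_lt_one hφ.1.le hφ.2).mul_left (φ ^ k)).mul_right (1 - φ)
    have hne : 1 - φ ≠ 0 := (sub_pos.2 hφ.2).ne'
    simpa only [← pow_add, mul_assoc, inv_mul_cancel₀ hne, mul_one] using h
  have hnonneg : ∀ m : ℕ, 0 ≤ φ ^ (k + m) * (1 - φ) := fun m =>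
    mul_nonneg (pow_nonneg hφ.1.le _) (sub_nonneg.2 hφ.2.le)
  have hmeas : ∀ m : ℕ, MeasurableSet {ω | Y ω = k + 1 + m} := fun m =>
    hY (measurableSet_singleton _)
  rw [hset, measure_iUnion _ hmeas, ← hsum.tsum_eq,
    ENNReal.ofReal_tsum_of_nonneg hnonneg hsum.summable]
  · refine tsum_congr fun m => ?_
    rw [hdist _ (by omega), show k + 1 + m - 1 = k + m by omega]
  · intro a b hab
    refine Set.disjoint_left.2 fun ω ha hb => hab ?_
    simp only [Set.mem_ofPred_eq] at ha hb
    omega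

/-- If independent variables exceed `k` with probability `p` each, then all those indexed by `S`
are at most `k` with probability at most `exp (-(p * #S))`. -/
lemma measure_forall_le_le_exp {Ω : Type*} [MeasurableSpace Ω] {μ : Measure Ω}
    [IsProbabilityMeasure μ] {ι : Type*} {X : ι → Ω → ℕ} (hmeas : ∀ i, Measurable (X i))
    (hindep : iIndepFun X μ) {p : ℝ} (hp : 0 ≤ p) {k : ℕ} (S : Finset ι)
    (htail : ∀ i ∈ S, μ {ω | k < X i ω} = ENNReal.ofReal p) :
    μ {ω | ∀ i ∈ S, X i ω ≤ k} ≤ ENNReal.ofReal (Real.exp (-(p * S.card))) := by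
  have hset : {ω | ∀ i ∈ S, X i ω ≤ k} = ⋂ i ∈ S, X i ⁻¹' Set.Iic k := by
    ext ω
    simp
  have hle : ∀ i ∈ S, μ (X i ⁻¹' Set.Iic k) ≤ ENNReal.ofReal (Real.exp (-p)) := by
    intro i hi
    have hcompl : X i ⁻¹' Set.Iic k = {ω | k < X i ω}ᶜ := by
      ext ω
      simp
    have hms : MeasurableSet {ω | k < X i ω} := hmeas i measurableSet_Ioi
    rw [hcompl, prob_compl_eq_one_sub hms, htail i hi,
      ← ENNReal.ofReal_one, ← ENNReal.ofReal_sub _ hp]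
    exact ENNReal.ofReal_le_ofReal (Real.one_sub_le_exp_neg p)
  rw [hset, hindep.measure_inter_preimage_eq_mul S fun _ _ => measurableSet_Iic]
  refine (Finset.prod_le_prod' hle).trans_eq ?_
  rw [Finset.prod_const, ← ENNReal.ofReal_pow (Real.exp_pos _).le, ← Real.exp_nat_mul]
  congr 2
  ring

/-- **Lemma 5.6, position of the representative.**
Let `φ ∈ (0,1)`, let `n` be such that `L := log₂ n > 1`, let `β ≥ 0` and `𝔠 > 0`,
let `h₁ ≥ 1` with `φ^h₁ = L^(-(β+𝔠))`, and let `N ≥ L^(β+2𝔠)` be a positive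
integer.  Let `h_1, …, h_N` be independent geometric heights with parameter `φ`
(index `i` corresponding to the data item of rank `i`) and let
`J = {i | h_i > h₁}`.  Then `P[∃ i ∈ J, i ≤ L^β] ≤ L^(-𝔠)` and
`P[J ∩ [1, L^(β+2𝔠)] = ∅] ≤ exp(-(1/2)·L^𝔠)`.  In particular, with probability
at least `1 - L^(-𝔠) - exp(-(1/2)·L^𝔠)`, the smallest index `i` with `h_i > h₁`
satisfies `L^β < i ≤ L^(β+2𝔠)`. -/
theorem representative_position
    {Ω : Type*} [MeasurableSpace Ω] (μ : Measure Ω) [IsProbabilityMeasure μ]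
    (φ : ℝ) (hφ : φ ∈ Set.Ioo (0 : ℝ) 1)
    (n : ℝ) (hn : 1 < Real.logb 2 n)
    (β 𝔠 : ℝ) (hβ : 0 ≤ β) (h𝔠 : 0 < 𝔠)
    (h₁ : ℕ) (h₁pos : 1 ≤ h₁) (hh₁ : φ ^ h₁ = Real.logb 2 n ^ (-(β + 𝔠)))
    (N : ℕ) (hNpos : 1 ≤ N) (hN : Real.logb 2 n ^ (β + 2 * 𝔠) ≤ (N : ℝ))
    (X : ℕ → Ω → ℕ)
    (hmeas : ∀ i, Measurable (X i))
    (hindep : iIndepFun X μ)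
    (hdist : ∀ i ∈ Finset.Icc 1 N, ∀ j : ℕ, 1 ≤ j →
      μ {ω | X i ω = j} = ENNReal.ofReal (φ ^ (j - 1) * (1 - φ))) :
    μ {ω | ∃ i ∈ Finset.Icc 1 N, h₁ < X i ω ∧ (i : ℝ) ≤ Real.logb 2 n ^ β}
      ≤ ENNReal.ofReal (Real.logb 2 n ^ (-𝔠)) ∧
    μ {ω | ∀ i ∈ Finset.Icc 1 N, (i : ℝ) ≤ Real.logb 2 n ^ (β + 2 * 𝔠) → X i ω ≤ h₁}
      ≤ ENNReal.ofReal (Real.exp (-(1 / 2) * Real.logb 2 n ^ 𝔠)) ∧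
    ENNReal.ofReal (1 - Real.logb 2 n ^ (-𝔠)
        - Real.exp (-(1 / 2) * Real.logb 2 n ^ 𝔠)) ≤
      μ {ω | ∃ i ∈ Finset.Icc 1 N, h₁ < X i ω ∧
        (∀ j ∈ Finset.Icc 1 N, j < i → X j ω ≤ h₁) ∧
        Real.logb 2 n ^ β < (i : ℝ) ∧ (i : ℝ) ≤ Real.logb 2 n ^ (β + 2 * 𝔠)} := by
  have hL : 0 < Real.logb 2 n := one_pos.trans hn
  set L := Real.logb 2 n
  have htail : ∀ i ∈ Finset.Icc 1 N, μ {ω | h₁ < X i ω} = ENNReal.ofReal (L ^ (-(β + 𝔠))) := by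
    intro i hi
    rw [measure_lt_of_geometric hφ (hmeas i) (hdist i hi), hh₁]
  have hp : 0 ≤ L ^ (-(β + 𝔠)) := (Real.rpow_pos_of_pos hL _).le
  have hearly : μ {ω | ∃ i ∈ Finset.Icc 1 N, h₁ < X i ω ∧ (i : ℝ) ≤ L ^ β}
      ≤ ENNReal.ofReal (L ^ (-𝔠)) := by
    set S := (Finset.Icc 1 N).filter fun i : ℕ => (i : ℝ) ≤ L ^ β with hS
    have hcard : (S.card : ℝ) ≤ L ^ β := by
      have hsub : S ⊆ Finset.Icc 1 ⌊L ^ β⌋₊ := by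
        intro i hi
        rw [hS, Finset.mem_filter, Finset.mem_Icc] at hi
        exact Finset.mem_Icc.2 ⟨hi.1.1, Nat.le_floor hi.2⟩
      have h := Finset.card_le_card hsub
      rw [Nat.card_Icc, Nat.add_sub_cancel] at h
      exact (Nat.cast_le.2 h).trans (Nat.floor_le (Real.rpow_pos_of_pos hL _).le)
    calc μ {ω | ∃ i ∈ Finset.Icc 1 N, h₁ < X i ω ∧ (i : ℝ) ≤ L ^ β}
        ≤ μ (⋃ i ∈ S, {ω | h₁ < X i ω}) := by
          refine measure_mono fun ω ⟨i, hi, hlt, hle⟩ => ?_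
          exact Set.mem_biUnion (Finset.mem_coe.2 (Finset.mem_filter.2 ⟨hi, hle⟩)) hlt
      _ ≤ ∑ i ∈ S, μ {ω | h₁ < X i ω} := measure_biUnion_finset_le _ _
      _ = ENNReal.ofReal (S.card * L ^ (-(β + 𝔠))) := by
          rw [Finset.sum_congr rfl fun i hi => htail i (Finset.mem_filter.1 hi).1,
            Finset.sum_const, nsmul_eq_mul, ENNReal.ofReal_mul (Nat.cast_nonneg _),
            ENNReal.ofReal_natCast]
      _ ≤ ENNReal.ofReal (L ^ (-𝔠)) := by
          refine ENNReal.ofReal_le_ofReal ((mul_le_mul_of_nonneg_right hcard hp).trans_eq ?_)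
          rw [← Real.rpow_add hL]
          congr 1
          ring
  have hlate : μ {ω | ∀ i ∈ Finset.Icc 1 N, (i : ℝ) ≤ L ^ (β + 2 * 𝔠) → X i ω ≤ h₁}
      ≤ ENNReal.ofReal (Real.exp (-(1 / 2) * L ^ 𝔠)) := by
    set M := L ^ (β + 2 * 𝔠) with hM
    have hM1 : 1 ≤ M := Real.one_le_rpow hn.le (by positivity)
    have hfloor : M / 2 ≤ (⌊M⌋₊ : ℝ) := by
      have h1 : (1 : ℝ) ≤ ⌊M⌋₊ := by exact_mod_cast (Nat.one_le_floor_iff M).2 hM1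
      linarith [Nat.lt_floor_add_one M]
    have hfloorN : ⌊M⌋₊ ≤ N := Nat.floor_le_of_le hN
    have hIcc : ∀ i ∈ Finset.Icc 1 ⌊M⌋₊, i ∈ Finset.Icc 1 N :=
      fun i hi => Finset.Icc_subset_Icc_right hfloorN hi
    calc μ {ω | ∀ i ∈ Finset.Icc 1 N, (i : ℝ) ≤ M → X i ω ≤ h₁}
        ≤ μ {ω | ∀ i ∈ Finset.Icc 1 ⌊M⌋₊, X i ω ≤ h₁} := by
          refine measure_mono fun ω h i hi => h i (hIcc i hi) ?_
          exact (Nat.le_floor_iff (by linarith)).1 (Finset.mem_Icc.1 hi).2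
      _ ≤ ENNReal.ofReal (Real.exp (-(L ^ (-(β + 𝔠)) * (Finset.Icc 1 ⌊M⌋₊).card))) :=
          measure_forall_le_le_exp hmeas hindep hp _ fun i hi => htail i (hIcc i hi)
      _ ≤ ENNReal.ofReal (Real.exp (-(1 / 2) * L ^ 𝔠)) := by
          refine ENNReal.ofReal_le_ofReal (Real.exp_le_exp.2 ?_)
          have hmul : L ^ (-(β + 𝔠)) * M = L ^ 𝔠 := by
            rw [hM, ← Real.rpow_add hL]
            congr 1
            ring
          rw [Nat.card_Icc, Nat.add_sub_cancel]
          linarith [mul_le_mul_of_nonneg_left hfloor hp]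
  refine ⟨hearly, hlate, ?_⟩
  set A := {ω | ∃ i ∈ Finset.Icc 1 N, h₁ < X i ω ∧ (i : ℝ) ≤ L ^ β}
  set B := {ω | ∀ i ∈ Finset.Icc 1 N, (i : ℝ) ≤ L ^ (β + 2 * 𝔠) → X i ω ≤ h₁}
  set G := {ω | ∃ i ∈ Finset.Icc 1 N, h₁ < X i ω ∧
    (∀ j ∈ Finset.Icc 1 N, j < i → X j ω ≤ h₁) ∧ L ^ β < (i : ℝ) ∧ (i : ℝ) ≤ L ^ (β + 2 * 𝔠)}
  have hcover : Set.univ ⊆ A ∪ B ∪ G := by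
    intro ω _
    by_cases hA : ω ∈ A
    · exact Or.inl (Or.inl hA)
    by_cases hB : ω ∈ B
    · exact Or.inl (Or.inr hB)
    refine Or.inr ?_
    simp only [A, B, Set.mem_ofPred_eq] at hA hB
    push Not at hA hB
    obtain ⟨m, hm, hmM, hmX⟩ := hB
    classical
    have hex : ∃ i, i ∈ Finset.Icc 1 N ∧ h₁ < X i ω := ⟨m, hm, hmX⟩
    obtain ⟨hi, hiX⟩ := Nat.find_spec hex
    refine ⟨Nat.find hex, hi, hiX, fun j hj hlt => ?_, hA _ hi hiX, ?_⟩
    · exact not_lt.1 fun h => Nat.find_min hex hlt ⟨hj, h⟩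
    · exact (Nat.cast_le.2 (Nat.find_min' hex ⟨hm, hmX⟩)).trans hmM
  have hone : 1 ≤ μ A + μ B + μ G := by
    rw [← measure_univ (μ := μ)]
    exact (measure_mono hcover).trans
      ((measure_union_le _ _).trans (add_le_add_left (measure_union_le _ _) _))
  rw [ENNReal.ofReal_sub _ (Real.exp_pos _).le,
    ENNReal.ofReal_sub _ (Real.rpow_pos_of_pos hL _).le, ENNReal.ofReal_one, tsub_tsub,
    tsub_le_iff_left]
  exact hone.trans (by gcongr)
end
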